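/- Let m, k₁, k₂ be integers with m ≥ 9 and 2 ≤ k₁ < k₁ + 1 < k₂ ≤ ⌊(m−1)/2⌋, and let f, g be the characteristic-type functions defined from the weight classes A, B, C, D. Then Re((f+g)^∧(0)) = 3^m − (3/2)·Σ_{j=1}^{k₂−1} 2^j·C(m,j), and for every w ∈ F₃^m with Hamming weight wt(w) = i ≥ 1, Re((f+g)^∧(w)) = −(3/2)·Ψ_{k₂−1}(i,m) + 3/2. -/

import Mathlib

open Finset

/-- `ζ₃ = e^{2πi/3}`, a primitive complex cube root of unity. -/
noncomputable def zeta3 : ℂ := Complex.exp (2 * Real.pi * Complex.I / 3)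

/-- `ζ₃^a` for `a ∈ F₃`. -/
noncomputable def chi (a : ZMod 3) : ℂ := zeta3 ^ a.val

/-- Standard inner product on `F₃^m`. -/
def dotp {m : ℕ} (w x : Fin m → ZMod 3) : ZMod 3 := ∑ i, w i * x i

/-- Walsh transform of `F : F₃^m → F₃`. -/
noncomputable def walsh {m : ℕ} (F : (Fin m → ZMod 3) → ZMod 3)
    (w : Fin m → ZMod 3) : ℂ :=
  ∑ x : Fin m → ZMod 3, chi (F x - dotp w x)

/-- Ternary Krawtchouk polynomial `K_t(x,m)`. -/
def Kraw (t x m : ℕ) : ℤ :=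
  ∑ j ∈ Finset.range (t + 1),
    (-1 : ℤ) ^ j * 2 ^ (t - j) * (x.choose j : ℤ) * ((m - x).choose (t - j) : ℤ)

/-- Lloyd polynomial `Ψ_k(x,m) = Σ_{t=0}^k K_t(x,m)`. -/
def Lloyd (k x m : ℕ) : ℤ := ∑ t ∈ Finset.range (k + 1), Kraw t x m

/-- `f(x) = 1` iff `x ∈ A ∪ C ∪ D`, i.e. `1 ≤ wt(x) ≤ k₂` and `wt(x) ≠ k₁`. -/
def ffun (m k₁ k₂ : ℕ) (x : Fin m → ZMod 3) : ZMod 3 :=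
  if 1 ≤ hammingNorm x ∧ hammingNorm x ≤ k₂ ∧ hammingNorm x ≠ k₁ then 1 else 0

/-- `g(x) = 1` on `B ∪ C` (i.e. `k₁ ≤ wt(x) ≤ k₂ - 1`), `g(x) = -1` on `D` (`wt(x) = k₂`). -/
def gfun (m k₁ k₂ : ℕ) (x : Fin m → ZMod 3) : ZMod 3 :=
  if k₁ ≤ hammingNorm x ∧ hammingNorm x ≤ k₂ - 1 then 1
  else if hammingNorm x = k₂ then -1 else 0

/-- The codeword `c(u,r,v)` of `C_{f,g}` for the specific `f = ffun`, `g = gfun`. -/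
def cw (m k₁ k₂ : ℕ) (u r : ZMod 3) (v : Fin m → ZMod 3) :
    {x : Fin m → ZMod 3 // x ≠ 0} → ZMod 3 :=
  fun x => u * ffun m k₁ k₂ x.1 + r * gfun m k₁ k₂ x.1 + dotp v x.1

/-- Hamming weight of the codeword `c(u,r,v)`. -/
def cwt (m k₁ k₂ : ℕ) (u r : ZMod 3) (v : Fin m → ZMod 3) : ℕ :=
  (Finset.univ.filter
    (fun x : {x : Fin m → ZMod 3 // x ≠ 0} => cw m k₁ k₂ u r v x ≠ 0)).card

theorem zeta3_pow_three : zeta3 ^ 3 = 1 := by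
  rw [zeta3, ← Complex.exp_nat_mul, ← Complex.exp_two_pi_mul_I]
  congr 1
  push_cast
  ring

theorem zeta3_eq : zeta3 = ⟨-1 / 2, √3 / 2⟩ := by
  have h : (2 * Real.pi * Complex.I / 3 : ℂ) = ((Real.pi - Real.pi / 3 : ℝ) : ℂ) * Complex.I := by
    push_cast
    ring
  rw [zeta3, h, Complex.exp_mul_I, ← Complex.ofReal_cos, ← Complex.ofReal_sin, Real.cos_pi_sub,
    Real.sin_pi_sub, Real.cos_pi_div_three, Real.sin_pi_div_three]
  apply Complex.ext <;> simp
  norm_num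

theorem one_add_zeta3_add_sq : 1 + zeta3 + zeta3 ^ 2 = 0 := by
  have h3 : √3 * √3 = (3 : ℝ) := Real.mul_self_sqrt (by norm_num)
  rw [zeta3_eq, sq]
  apply Complex.ext <;> simp <;> linarith

theorem chi_zero : chi 0 = 1 := by
  simp [chi]

theorem chi_add (a b : ZMod 3) : chi (a + b) = chi a * chi b := by
  rw [chi, chi, chi, ← pow_add, ZMod.val_add, ← pow_eq_pow_mod _ zeta3_pow_three]

theorem chi_sum {ι : Type*} (s : Finset ι) (a : ι → ZMod 3) :
    chi (∑ i ∈ s, a i) = ∏ i ∈ s, chi (a i) := by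
  classical
  induction s using Finset.induction_on with
  | empty => simp [chi_zero]
  | insert i s hi ih => rw [sum_insert hi, prod_insert hi, chi_add, ih]

theorem chi_one_add_chi_two : chi 1 + chi 2 = -1 := by
  have h2 : (2 : ZMod 3).val = 2 := rfl
  rw [chi, chi, ZMod.val_one, h2]
  linear_combination one_add_zeta3_add_sq

theorem chi_re (a : ZMod 3) : (chi a).re = if a = 0 then 1 else -1 / 2 := by
  have h1 : (chi 1).re = -1 / 2 := by simp [chi, ZMod.val_one, zeta3_eq]
  have h12 := congrArg Complex.re chi_one_add_chi_two
  rw [Complex.add_re, h1, Complex.neg_re, Complex.one_re] at h12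
  have h2 : (chi 2).re = -1 / 2 := by linarith
  have ha : a = 0 ∨ a = 1 ∨ a = 2 := by revert a; decide
  rcases ha with rfl | rfl | rfl
  · simp [chi_zero]
  · rw [h1, if_neg (by decide)]
  · rw [h2, if_neg (by decide)]

open Polynomial in
/-- The weight enumerator of `F₃^m` twisted by the additive character `x ↦ ζ₃^(-w·x)`. -/
theorem twisted_weight_enumerator {m : ℕ} (w : Fin m → ZMod 3) :
    ∑ x : Fin m → ZMod 3, C (chi (-dotp w x)) * X ^ hammingNorm x =
      (1 + C (-1) * X) ^ hammingNorm w * (1 + C 2 * X) ^ (m - hammingNorm w) := by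
  have hterm (x : Fin m → ZMod 3) : C (chi (-dotp w x)) * X ^ hammingNorm x =
      ∏ i, (C (chi (-(w i * x i))) * if x i ≠ 0 then X else 1) := by
    rw [prod_mul_distrib, ← map_prod, ← chi_sum, sum_neg_distrib, dotp, prod_ite]
    simp [hammingNorm]
  have hfactor (b : ZMod 3) : ∑ a : ZMod 3, C (chi (-(b * a))) * (if a ≠ 0 then X else 1) =
      if b ≠ 0 then 1 + C (-1) * X else 1 + C 2 * X := by
    have h12 : (C (chi 1) + C (chi 2) : ℂ[X]) = C (-1) := by rw [← C_add, chi_one_add_chi_two]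
    have hsum (φ : ZMod 3 → ℂ[X]) : ∑ a, φ a = φ 0 + φ 1 + φ 2 := Fin.sum_univ_three φ
    have h1 : (1 : ZMod 3) ≠ 0 := by decide
    have h2 : (2 : ZMod 3) ≠ 0 := by decide
    have hb : b = 0 ∨ b = 1 ∨ b = 2 := by revert b; decide
    have e1 : (-1 : ZMod 3) = 2 := by decide
    have e2 : (-2 : ZMod 3) = 1 := by decide
    have e3 : (-(2 * 2) : ZMod 3) = 2 := by decide
    have hC2 : (C 2 : ℂ[X]) = 2 := rfl
    rw [hsum, ← h12]
    rcases hb with rfl | rfl | rfl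
    · simp [h1, h2, chi_zero, hC2]
      ring
    · simp only [h1, h2, e1, e2, mul_zero, neg_zero, one_mul, chi_zero, map_one, ne_eq,
        not_true_eq_false, not_false_eq_true, if_true, if_false]
      ring
    · simp only [h1, h2, e2, e3, mul_zero, neg_zero, mul_one, chi_zero, map_one, ne_eq,
        not_true_eq_false, not_false_eq_true, if_true, if_false]
      ring
  have hcard : #{i | ¬ w i ≠ 0} = m - hammingNorm w := by
    have h := card_filter_add_card_filter_not (s := univ) (fun i => w i ≠ 0)
    rw [card_univ, Fintype.card_fin] at h
    rw [hammingNorm]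
    omega
  rw [sum_congr rfl fun x _ => hterm x, ← Fintype.piFinset_univ,
    ← prod_univ_sum (fun _ => univ) fun i a => C (chi (-(w i * a))) * if a ≠ 0 then X else 1,
    prod_congr rfl fun i _ => hfactor (w i), prod_ite, prod_const, prod_const, hcard, hammingNorm]

open Polynomial in
theorem coeff_one_add_C_mul_X_pow {R : Type*} [CommSemiring R] (a : R) (n t : ℕ) :
    ((1 + C a * X) ^ n).coeff t = a ^ t * n.choose t := by
  have h : (1 + C a * X) ^ n = ((1 + X) ^ n : R[X]).comp (C a * X) := by simp
  rw [h, comp_C_mul_X_coeff, coeff_one_add_X_pow, mul_comm]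

open Polynomial in
theorem sum_chi_neg_dotp_weight_class {m : ℕ} (w : Fin m → ZMod 3) (t : ℕ) :
    ∑ x with hammingNorm x = t, chi (-dotp w x) = (Kraw t (hammingNorm w) m : ℂ) := by
  have h := congrArg (coeff · t) (twisted_weight_enumerator w)
  simp only [finsetSum_coeff, coeff_C_mul, coeff_X_pow, mul_ite, mul_one, mul_zero] at h
  simp only [coeff_mul, coeff_one_add_C_mul_X_pow] at h
  rw [Finset.Nat.sum_antidiagonal_eq_sum_range_succ_mk] at h
  rw [sum_filter, sum_congr rfl fun x _ => if_congr eq_comm rfl rfl, h, Kraw]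
  push_cast
  exact sum_congr rfl fun j _ => by ring

theorem sum_Kraw {m : ℕ} (w : Fin m → ZMod 3) :
    ∑ t ∈ range (m + 1), (Kraw t (hammingNorm w) m : ℂ) =
      0 ^ hammingNorm w * 3 ^ (m - hammingNorm w) := by
  have h := congrArg (Polynomial.eval 1) (twisted_weight_enumerator w)
  simp only [Polynomial.eval_finsetSum, Polynomial.eval_mul, Polynomial.eval_C,
    Polynomial.eval_pow, Polynomial.eval_X, Polynomial.eval_add, Polynomial.eval_one, one_pow,
    mul_one] at h
  norm_num at h
  rw [← h, ← sum_fiberwise_of_maps_to (s := univ) (t := range (m + 1)) (g := hammingNorm)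
    fun x _ => mem_range_succ_iff.2 (hammingNorm_le_card_fintype.trans_eq (Fintype.card_fin m))]
  exact sum_congr rfl fun t _ => (sum_chi_neg_dotp_weight_class w t).symm

/-- The Walsh transform of a function of the Hamming weight, in terms of Krawtchouk polynomials. -/
theorem walsh_comp_hammingNorm {m : ℕ} (φ : ℕ → ZMod 3) (w : Fin m → ZMod 3) :
    walsh (fun x => φ (hammingNorm x)) w =
      ∑ t ∈ range (m + 1), chi (φ t) * Kraw t (hammingNorm w) m := by
  rw [walsh, ← sum_fiberwise_of_maps_to (s := univ) (t := range (m + 1)) (g := hammingNorm)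
    fun x _ => mem_range_succ_iff.2 (hammingNorm_le_card_fintype.trans_eq (Fintype.card_fin m))]
  refine sum_congr rfl fun t _ => ?_
  rw [← sum_chi_neg_dotp_weight_class, mul_sum]
  refine sum_congr rfl fun x hx => ?_
  rw [(mem_filter.1 hx).2, sub_eq_add_neg, chi_add]

theorem walsh_comp_hammingNorm_re {m : ℕ} (φ : ℕ → ZMod 3) (w : Fin m → ZMod 3) (s : Finset ℕ)
    (hs : s ⊆ range (m + 1)) (hφ : ∀ t, φ t ≠ 0 ↔ t ∈ s) :
    (walsh (fun x => φ (hammingNorm x)) w).re =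
      0 ^ hammingNorm w * 3 ^ (m - hammingNorm w) -
        3 / 2 * ∑ t ∈ s, (Kraw t (hammingNorm w) m : ℝ) := by
  have hK : ∑ t ∈ range (m + 1), (Kraw t (hammingNorm w) m : ℝ) =
      0 ^ hammingNorm w * 3 ^ (m - hammingNorm w) := by
    exact_mod_cast sum_Kraw w
  rw [walsh_comp_hammingNorm, Complex.re_sum, ← hK, ← inter_eq_right.2 hs, ← sum_ite_mem, mul_sum,
    ← sum_sub_distrib]
  refine sum_congr rfl fun t _ => ?_
  rw [← Complex.ofReal_intCast, Complex.re_mul_ofReal, chi_re]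
  by_cases h : t ∈ s
  · rw [if_neg ((hφ t).2 h), if_pos h]
    ring
  · rw [if_pos (not_not.1 (mt (hφ t).1 h)), if_neg h]
    ring

theorem Kraw_zero_right (t m : ℕ) : Kraw t 0 m = 2 ^ t * m.choose t := by
  rw [Kraw, sum_eq_single 0]
  · simp
  · intro j _ hj
    simp [Nat.choose_eq_zero_of_lt (Nat.pos_of_ne_zero hj)]
  · simp

theorem Kraw_zero_left (x m : ℕ) : Kraw 0 x m = 1 := by
  simp [Kraw]

theorem Lloyd_eq_one_add_sum (k x m : ℕ) : Lloyd k x m = 1 + ∑ t ∈ Icc 1 k, Kraw t x m := by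
  rw [Lloyd, range_eq_Ico, sum_eq_sum_Ico_succ_bot (Nat.succ_pos k), Kraw_zero_left]
  rfl

theorem walsh_ffun_add_gfun_re {m k₁ k₂ : ℕ} (hk₁ : 1 ≤ k₁) (hk : k₁ < k₂) (hk₂ : k₂ ≤ m)
    (w : Fin m → ZMod 3) :
    (walsh (ffun m k₁ k₂ + gfun m k₁ k₂) w).re =
      0 ^ hammingNorm w * 3 ^ (m - hammingNorm w) -
        3 / 2 * ∑ t ∈ Icc 1 (k₂ - 1), (Kraw t (hammingNorm w) m : ℝ) := by
  refine walsh_comp_hammingNorm_re (fun t => (if 1 ≤ t ∧ t ≤ k₂ ∧ t ≠ k₁ then 1 else 0) +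
    if k₁ ≤ t ∧ t ≤ k₂ - 1 then 1 else if t = k₂ then -1 else 0) w _ ?_ fun t => ?_
  · intro t ht
    rw [mem_Icc] at ht
    rw [mem_range]
    omega
  · have h2 : (1 + 1 : ZMod 3) ≠ 0 := by decide
    rw [mem_Icc]
    split_ifs <;> simp [h2] <;> omega

theorem stmt5 (m k₁ k₂ : ℕ) (hm : 9 ≤ m) (hk₁ : 2 ≤ k₁) (hk : k₁ + 1 < k₂)
    (hk₂ : k₂ ≤ (m - 1) / 2) :
    (walsh (ffun m k₁ k₂ + gfun m k₁ k₂) (0 : Fin m → ZMod 3)).re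
      = 3 ^ m - 3 / 2 * (∑ j ∈ Finset.Icc 1 (k₂ - 1), (2 : ℝ) ^ j * (m.choose j : ℝ)) ∧
    ∀ (w : Fin m → ZMod 3) (i : ℕ), hammingNorm w = i → 1 ≤ i →
      (walsh (ffun m k₁ k₂ + gfun m k₁ k₂) w).re
        = -(3 / 2) * (Lloyd (k₂ - 1) i m : ℝ) + 3 / 2 := by
  refine ⟨?_, ?_⟩
  · rw [walsh_ffun_add_gfun_re (by omega) (by omega) (by omega)]
    simp [Kraw_zero_right]
  · rintro w i rfl hi
    rw [walsh_ffun_add_gfun_re (by omega) (by omega) (by omega), Lloyd_eq_one_add_sum,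
      zero_pow (by omega)]
    push_cast
    ring
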